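/- arXiv:1605.05968 — 2 statements merged into one kernel-verified Lean document; each statement's English description precedes it below -/
import Mathlib

section
/- Let λ ≥ 0 and let F^c : [0,∞) → [0,1] be nonincreasing and integrable with ∫_0^∞ F^c(ξ) dξ = 1. Then for every t ≥ 0, sup_{w ≥ 0} |x^↑_w(t) − x*_w| ≤ λ ∫_t^∞ F^c(ξ) dξ; consequently sup_{w ≥ 0} |x^↑_w(t) − x*_w| → 0 as t → ∞, i.e., x^↑(t) converges to x* uniformly in w. -/
open MeasureTheory Set Filter

/-- `sup_{w ≥ 0} |x^↑_w(t) − x*_w| ≤ λ ∫_t^∞ F^c(ξ) dξ` for every `t ≥ 0`,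
and consequently `x^↑(t) → x*` uniformly in `w ≥ 0` as `t → ∞`. -/
theorem stmt_2 (lam : ℝ) (hlam : 0 ≤ lam) (Fc : ℝ → ℝ)
    (hrange : ∀ ξ ≥ 0, Fc ξ ∈ Set.Icc (0:ℝ) 1)
    (hanti : AntitoneOn Fc (Set.Ici 0))
    (hint : IntegrableOn Fc (Set.Ici 0))
    (hmean : ∫ ξ in Set.Ici (0:ℝ), Fc ξ = 1) :
    (∀ t ≥ (0:ℝ), ∀ w ≥ (0:ℝ),
      |(lam * ∫ ξ in w..(w + t), Fc ξ) - (lam * ∫ ξ in Set.Ioi w, Fc ξ)|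
        ≤ lam * ∫ ξ in Set.Ioi t, Fc ξ) ∧
    (∀ ε > (0:ℝ), ∃ T : ℝ, ∀ t ≥ T, ∀ w ≥ (0:ℝ),
      |(lam * ∫ ξ in w..(w + t), Fc ξ) - (lam * ∫ ξ in Set.Ioi w, Fc ξ)| < ε) := by
  have hint' : IntegrableOn Fc (Ioi 0) := hint.mono_set Ioi_subset_Ici_self
  have hbound : ∀ t ≥ (0:ℝ), ∀ w ≥ (0:ℝ),
      |(lam * ∫ ξ in w..(w + t), Fc ξ) - (lam * ∫ ξ in Set.Ioi w, Fc ξ)|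
        ≤ lam * ∫ ξ in Set.Ioi t, Fc ξ := by
    intro t ht w hw
    have hwt : 0 ≤ w + t := add_nonneg hw ht
    have hsplit := intervalIntegral.integral_interval_add_Ioi
      (hint'.mono_set (Ioi_subset_Ioi hw)) (hint'.mono_set (Ioi_subset_Ioi hwt))
    have hnonneg : 0 ≤ ∫ ξ in Ioi (w + t), Fc ξ :=
      setIntegral_nonneg measurableSet_Ioi fun ξ hξ => (hrange ξ (hwt.trans hξ.le)).1
    have hmono : ∫ ξ in Ioi (w + t), Fc ξ ≤ ∫ ξ in Ioi t, Fc ξ := by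
      refine setIntegral_mono_set (hint'.mono_set (Ioi_subset_Ioi ht)) ?_
        (Ioi_subset_Ioi (le_add_of_nonneg_left hw)).eventuallyLE
      filter_upwards [ae_restrict_mem measurableSet_Ioi] with ξ hξ
      exact (hrange ξ (ht.trans (le_of_lt hξ))).1
    rw [← hsplit, ← mul_sub, sub_add_cancel_left, abs_mul, abs_neg, abs_of_nonneg hlam,
      abs_of_nonneg hnonneg]
    exact mul_le_mul_of_nonneg_left hmono hlam
  refine ⟨hbound, fun ε hε => ?_⟩
  have hlim : Tendsto (fun t => lam * ∫ ξ in Ioi t, Fc ξ) atTop (nhds 0) := by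
    simpa using (tendsto_integral_Ioi_zero (f := Fc) (μ := volume) tendsto_id).const_mul lam
  obtain ⟨T, hT⟩ := eventually_atTop.1
    ((hlim.eventually_lt_const hε).and (eventually_ge_atTop 0))
  exact ⟨T, fun t ht w hw => (hbound t (hT t ht).2 w hw).trans_lt (hT t ht).1⟩
end

section
/- For each n ≥ 1, let (ξ^n_1, …, ξ^n_n) be an exchangeable random vector of nonnegative real random variables, i.e., for every permutation σ of {1, …, n}, the joint law of (ξ^n_{σ(1)}, …, ξ^n_{σ(n)}) equals that of (ξ^n_1, …, ξ^n_n). Let c : [0,∞) → [0,1] and suppose that for every w ≥ 0, the empirical tail fraction (1/n) #{i ≤ n : ξ^n_i > w} converges in probability to the constant c(w) as n → ∞. Then for every fixed m ≥ 1 and all w_1, …, w_m ≥ 0, P(ξ^n_1 > w_1, …, ξ^n_m > w_m) → Π_{j=1}^m c(w_j) as n → ∞. -/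
open MeasureTheory Set Filter ProbabilityTheory

/-- If `μ (D ∩ B i)` does not depend on `i` for `i ≥ k`, then `μ (D ∩ B k)` is within `k / n` of the
average of `μ (D ∩ B i)` over all `i`. -/
lemma abs_measureReal_inter_sub_average_le {α : Type*} [MeasurableSpace α] (μ : Measure α)
    [IsProbabilityMeasure μ] {n : ℕ} (D : Set α) (B : Fin n → Set α) (k : Fin n)
    (h : ∀ i, k ≤ i → μ.real (D ∩ B i) = μ.real (D ∩ B k)) :
    |μ.real (D ∩ B k) - (1 / (n : ℝ)) * ∑ i, μ.real (D ∩ B i)| ≤ (k : ℝ) / n := by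
  have hn : (0 : ℝ) < n := by exact_mod_cast k.pos
  have hterm (i : Fin n) :
      |μ.real (D ∩ B k) - μ.real (D ∩ B i)| ≤ if i < k then (1 : ℝ) else 0 := by
    split_ifs with hi
    · exact abs_sub_le_of_nonneg_of_le measureReal_nonneg measureReal_le_one
        measureReal_nonneg measureReal_le_one
    · simp [h i (not_lt.mp hi)]
  have hsum : |∑ i, (μ.real (D ∩ B k) - μ.real (D ∩ B i))| ≤ (k : ℝ) := by
    refine (Finset.abs_sum_le_sum_abs _ _).trans ((Finset.sum_le_sum fun i _ => hterm i).trans ?_)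
    rw [Finset.sum_boole, Finset.filter_gt_eq_Iio, Fin.card_Iio]
  have heq : μ.real (D ∩ B k) - (1 / (n : ℝ)) * ∑ i, μ.real (D ∩ B i)
      = (∑ i, (μ.real (D ∩ B k) - μ.real (D ∩ B i))) / n := by
    rw [Finset.sum_sub_distrib, Finset.sum_const, Finset.card_univ, Fintype.card_fin, nsmul_eq_mul]
    field_simp
  rw [heq, abs_div, abs_of_pos hn]
  gcongr

lemma abs_setIntegral_sub_mul_le {α : Type*} [MeasurableSpace α] (μ : Measure α)
    [IsProbabilityMeasure μ] {X : α → ℝ} (hX : Measurable X) (hX01 : ∀ ω, X ω ∈ Set.Icc (0 : ℝ) 1)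
    {c : ℝ} (hc : c ∈ Set.Icc (0 : ℝ) 1) (D : Set α) {ε : ℝ} (hε : 0 < ε) :
    |∫ ω in D, X ω ∂μ - c * μ.real D| ≤ ε + μ.real {ω | ε < |X ω - c|} := by
  have hXint : Integrable X μ := Integrable.of_bound hX.aestronglyMeasurable 1
    (ae_of_all _ fun ω => by rw [Real.norm_of_nonneg (hX01 ω).1]; exact (hX01 ω).2)
  have hint : Integrable (fun ω => |X ω - c|) μ := (hXint.sub (integrable_const c)).abs
  have hS : MeasurableSet {ω | ε < |X ω - c|} :=
    measurableSet_lt measurable_const (by fun_prop)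
  have hind : Integrable ({ω | ε < |X ω - c|}.indicator (1 : α → ℝ)) μ :=
    (integrable_const (1 : ℝ)).indicator hS
  calc |∫ ω in D, X ω ∂μ - c * μ.real D|
      = |∫ ω in D, (X ω - c) ∂μ| := by
        rw [integral_sub hXint.integrableOn (integrable_const c).integrableOn, setIntegral_const,
          smul_eq_mul, mul_comm c]
    _ ≤ ∫ ω in D, |X ω - c| ∂μ := abs_integral_le_integral_abs
    _ ≤ ∫ ω, |X ω - c| ∂μ := setIntegral_le_integral hint (ae_of_all _ fun ω => abs_nonneg _)
    _ ≤ ∫ ω, (ε + {ω | ε < |X ω - c|}.indicator 1 ω) ∂μ := by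
        refine integral_mono hint ((integrable_const ε).add hind) fun ω => ?_
        by_cases hω : ε < |X ω - c|
        · have h1 : |X ω - c| ≤ 1 :=
            abs_sub_le_of_nonneg_of_le (hX01 ω).1 (hX01 ω).2 hc.1 hc.2
          simp only [indicator, mem_ofPred_eq, hω, if_true, Pi.one_apply]
          linarith
        · simpa [indicator, hω] using not_lt.mp hω
    _ = ε + μ.real {ω | ε < |X ω - c|} := by
        rw [integral_add (integrable_const ε) hind, integral_indicator_one hS]
        simp

lemma setIntegral_empirical_fraction {α : Type*} [MeasurableSpace α] (μ : Measure α)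
    [IsProbabilityMeasure μ] {n : ℕ} {ξ : Fin n → α → ℝ} (hξ : ∀ i, Measurable (ξ i)) (w : ℝ)
    (D : Set α) :
    ∫ ω in D, (1 / (n : ℝ)) * ((Finset.univ.filter (fun i : Fin n => w < ξ i ω)).card : ℝ) ∂μ
      = (1 / (n : ℝ)) * ∑ i, μ.real (D ∩ {ω | w < ξ i ω}) := by
  have hB (i : Fin n) : MeasurableSet {ω | w < ξ i ω} := measurableSet_lt measurable_const (hξ i)
  have hcard (ω : α) : ((Finset.univ.filter (fun i : Fin n => w < ξ i ω)).card : ℝ)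
      = ∑ i, {ω | w < ξ i ω}.indicator (1 : α → ℝ) ω := by
    simp [indicator]
  have hint (i : Fin n) :
      Integrable ({ω | w < ξ i ω}.indicator (1 : α → ℝ)) (μ.restrict D) :=
    (integrable_const (1 : ℝ)).indicator (hB i)
  simp_rw [hcard]
  rw [integral_const_mul, integral_finsetSum _ fun i _ => hint i]
  congr 1
  refine Finset.sum_congr rfl fun i _ => ?_
  rw [integral_indicator_one (hB i), measureReal_restrict_apply (hB i), inter_comm]

lemma measurable_empirical_fraction {α : Type*} [MeasurableSpace α] {n : ℕ} {ξ : Fin n → α → ℝ}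
    (hξ : ∀ i, Measurable (ξ i)) (w : ℝ) :
    Measurable fun ω =>
      (1 / (n : ℝ)) * ((Finset.univ.filter (fun i : Fin n => w < ξ i ω)).card : ℝ) := by
  simp_rw [Finset.card_filter, Nat.cast_sum]
  refine measurable_const.mul (Finset.measurable_fun_sum _ fun i _ => ?_)
  push_cast
  exact Measurable.ite (measurableSet_lt measurable_const (hξ i)) measurable_const measurable_const

lemma empirical_fraction_mem_Icc {n : ℕ} (p : Fin n → Prop) [DecidablePred p] :
    (1 / (n : ℝ)) * ((Finset.univ.filter p).card : ℝ) ∈ Set.Icc (0 : ℝ) 1 := by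
  refine ⟨by positivity, ?_⟩
  rw [one_div_mul_eq_div]
  refine div_le_one_of_le₀ ?_ n.cast_nonneg
  exact_mod_cast (Finset.card_le_univ _).trans (Fintype.card_fin n).le

/-- For an exchangeable vector, the joint tail probability of the first `k` coordinates and a later
coordinate `i` does not depend on `i`. -/
lemma measureReal_joint_tail_eq {α : Type*} [MeasurableSpace α] (μ : Measure α) {n : ℕ}
    {ξ : Fin n → α → ℝ} (hξ : ∀ i, Measurable (ξ i))
    (hexch : ∀ σ : Equiv.Perm (Fin n),
      Measure.map (fun ω (i : Fin n) => ξ (σ i) ω) μ = Measure.map (fun ω (i : Fin n) => ξ i ω) μ)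
    (k : Fin n) (w : Fin k → ℝ) (v : ℝ) {i : Fin n} (hi : k ≤ i) :
    μ.real ({ω | ∀ j : Fin k, ∀ h : (j : ℕ) < n, w j < ξ ⟨j, h⟩ ω} ∩ {ω | v < ξ i ω})
      = μ.real ({ω | ∀ j : Fin k, ∀ h : (j : ℕ) < n, w j < ξ ⟨j, h⟩ ω} ∩ {ω | v < ξ k ω}) := by
  let S : Set (Fin n → ℝ) :=
    {x | ∀ j : Fin k, ∀ h : (j : ℕ) < n, w j < x ⟨j, h⟩} ∩ {x | v < x k}
  have hS : MeasurableSet S := by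
    refine MeasurableSet.inter ?_ (measurableSet_lt measurable_const (measurable_pi_apply k))
    simp_rw [ofPred_forall]
    exact MeasurableSet.iInter fun j => MeasurableSet.iInter fun h =>
      measurableSet_lt measurable_const (measurable_pi_apply _)
  have hmap := congrArg (fun ν : Measure (Fin n → ℝ) => ν.real S) (hexch (Equiv.swap k i))
  beta_reduce at hmap
  rw [map_measureReal_apply (measurable_pi_lambda _ fun j => hξ _) hS,
    map_measureReal_apply (measurable_pi_lambda _ fun j => hξ _) hS] at hmap
  refine Eq.trans (congrArg μ.real ?_) hmap
  ext ω
  simp only [S, mem_inter_iff, mem_ofPred_eq, mem_preimage, Equiv.swap_apply_left]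
  refine and_congr_left fun _ => forall_congr' fun j => forall_congr' fun h => ?_
  have hjk : (⟨j, h⟩ : Fin n) < k := j.2
  rw [Equiv.swap_apply_of_ne_of_ne hjk.ne (hjk.trans_le hi).ne]

lemma abs_joint_tail_succ_sub_le {α : Type*} [MeasurableSpace α] (μ : Measure α)
    [IsProbabilityMeasure μ] {n : ℕ} {ξ : Fin n → α → ℝ} (hξ : ∀ i, Measurable (ξ i))
    (hexch : ∀ σ : Equiv.Perm (Fin n),
      Measure.map (fun ω (i : Fin n) => ξ (σ i) ω) μ = Measure.map (fun ω (i : Fin n) => ξ i ω) μ)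
    {m : ℕ} (hm : m < n) (w : Fin (m + 1) → ℝ) {c : ℝ} (hc : c ∈ Set.Icc (0 : ℝ) 1)
    {ε : ℝ} (hε : 0 < ε) :
    |μ.real {ω | ∀ j : Fin (m + 1), ∀ h : (j : ℕ) < n, w j < ξ ⟨j, h⟩ ω}
        - c * μ.real {ω | ∀ j : Fin m, ∀ h : (j : ℕ) < n, w j.castSucc < ξ ⟨j, h⟩ ω}|
      ≤ (m : ℝ) / n + (ε + μ.real {ω | ε < |(1 / (n : ℝ)) *
          ((Finset.univ.filter (fun i : Fin n => w (Fin.last m) < ξ i ω)).card : ℝ) - c|}) := by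
  set D := {ω | ∀ j : Fin m, ∀ h : (j : ℕ) < n, w j.castSucc < ξ ⟨j, h⟩ ω}
  have hD : {ω | ∀ j : Fin (m + 1), ∀ h : (j : ℕ) < n, w j < ξ ⟨j, h⟩ ω}
      = D ∩ {ω | w (Fin.last m) < ξ ⟨m, hm⟩ ω} := by
    ext ω
    simp [D, Fin.forall_fin_succ', hm]
  rw [hD]
  have h1 := abs_measureReal_inter_sub_average_le μ D (fun i => {ω | w (Fin.last m) < ξ i ω})
    ⟨m, hm⟩ fun i hi =>
      measureReal_joint_tail_eq μ hξ hexch ⟨m, hm⟩ (fun j => w j.castSucc) (w (Fin.last m)) hi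
  have h2 := abs_setIntegral_sub_mul_le μ (measurable_empirical_fraction hξ (w (Fin.last m)))
    (fun ω => empirical_fraction_mem_Icc _) hc D hε
  rw [setIntegral_empirical_fraction μ hξ] at h2
  exact (abs_sub_le _ _ _).trans (add_le_add h1 h2)

/-- asymptotic independence from exchangeability plus concentration of
the empirical tail: if for each `n` the vector `(ξ^n_1,…,ξ^n_n)` of nonnegative
random variables is exchangeable and the empirical tail fraction
`(1/n) #{i : ξ^n_i > w}` converges in probability to the constant `c(w)` for every
`w ≥ 0`, then for every fixed `m` and `w_1,…,w_m ≥ 0`,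
`P(ξ^n_1 > w_1, …, ξ^n_m > w_m) → Π_j c(w_j)`. -/
theorem stmt_13 (Ω : ℕ → Type*) [∀ n, MeasureSpace (Ω n)]
    [∀ n, IsProbabilityMeasure (ℙ : Measure (Ω n))]
    (ξ : ∀ n, Fin n → Ω n → ℝ)
    (hmeas : ∀ n i, Measurable (ξ n i))
    (hnonneg : ∀ n i ω, 0 ≤ ξ n i ω)
    (hexch : ∀ n (σ : Equiv.Perm (Fin n)),
      Measure.map (fun ω (i : Fin n) => ξ n (σ i) ω) (ℙ : Measure (Ω n))
        = Measure.map (fun ω (i : Fin n) => ξ n i ω) (ℙ : Measure (Ω n)))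
    (c : ℝ → ℝ) (hc : ∀ w ≥ (0:ℝ), c w ∈ Set.Icc (0:ℝ) 1)
    (hconc : ∀ w ≥ (0:ℝ), ∀ ε > (0:ℝ),
      Tendsto (fun n =>
        ℙ {ω : Ω n | ε <
          |(1 / (n:ℝ)) * ((Finset.univ.filter (fun i : Fin n => w < ξ n i ω)).card : ℝ)
            - c w|})
        atTop (nhds 0)) :
    ∀ m : ℕ, 1 ≤ m → ∀ w : Fin m → ℝ, (∀ j, 0 ≤ w j) →
      Tendsto (fun n =>
        (ℙ {ω : Ω n | ∀ j : Fin m, ∀ h : (j : ℕ) < n, w j < ξ n ⟨(j : ℕ), h⟩ ω}).toReal)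
        atTop (nhds (∏ j, c (w j))) := by
  suffices H : ∀ m : ℕ, ∀ w : Fin m → ℝ, (∀ j, 0 ≤ w j) →
      Tendsto (fun n => (ℙ : Measure (Ω n)).real
        {ω : Ω n | ∀ j : Fin m, ∀ h : (j : ℕ) < n, w j < ξ n ⟨(j : ℕ), h⟩ ω})
        atTop (nhds (∏ j, c (w j))) from fun m _ => H m
  intro m
  induction m with
  | zero => intro w _; simp
  | succ m ih =>
    intro w hw
    have hlast := hw (Fin.last m)
    have hprev := ih (fun j => w j.castSucc) fun j => hw _
    have hdiff : Tendsto (fun n =>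
        (ℙ : Measure (Ω n)).real
          {ω : Ω n | ∀ j : Fin (m + 1), ∀ h : (j : ℕ) < n, w j < ξ n ⟨(j : ℕ), h⟩ ω}
        - c (w (Fin.last m)) * (ℙ : Measure (Ω n)).real
          {ω : Ω n | ∀ j : Fin m, ∀ h : (j : ℕ) < n, w j.castSucc < ξ n ⟨(j : ℕ), h⟩ ω})
        atTop (nhds 0) := by
      rw [Metric.tendsto_nhds]
      intro ε hε
      have hprob : Tendsto (fun n => (ℙ : Measure (Ω n)).real {ω : Ω n | ε / 2 < |(1 / (n:ℝ)) *
          ((Finset.univ.filter (fun i : Fin n => w (Fin.last m) < ξ n i ω)).card : ℝ)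
            - c (w (Fin.last m))|}) atTop (nhds 0) :=
        (ENNReal.tendsto_toReal ENNReal.zero_ne_top).comp (hconc _ hlast _ (half_pos hε))
      have hbound := (tendsto_const_div_atTop_nhds_zero_nat (m : ℝ)).add (hprob.const_add (ε / 2))
      filter_upwards [eventually_gt_atTop m,
        hbound.eventually_lt_const (show 0 + (ε / 2 + 0) < ε by linarith)] with n hn hlt
      rw [Real.dist_eq, sub_zero]
      exact (abs_joint_tail_succ_sub_le ℙ (hmeas n) (hexch n) hn w (hc _ hlast)
        (half_pos hε)).trans_lt hlt
    rw [Fin.prod_univ_castSucc, mul_comm]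
    simpa using hdiff.add (hprev.const_mul (c (w (Fin.last m))))
end
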